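/- There is a constant c > 0 (depending only on sup_n m_n) such that for all N ∈ ℕ, all 0 ≤ i < j ≤ N, all x ∈ I_N^{i,j}, and all integers n ≥ M_N: ∫_{I_N} |K_n(x − t)| dμ(t) ≤ c · M_i M_j / M_N². -/

import Mathlib

open MeasureTheory Filter
open scoped ENNReal NNReal Real BigOperators

noncomputable section

namespace Vilenkin

instance (k : ℕ) : MeasurableSpace (ZMod k) := ⊤

/-- The Vilenkin group: the product of the cyclic groups `ZMod (m n)`. -/
abbrev G (m : ℕ → ℕ) : Type := ∀ n : ℕ, ZMod (m n)

variable (m : ℕ → ℕ)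

/-- The generalized powers `M_0 = 1`, `M_{n+1} = m_n M_n`. -/
def Mprod : ℕ → ℕ
  | 0 => 1
  | n + 1 => m n * Mprod n

/-- The `k`-th digit of `n` in the base-`M` expansion `n = Σ_k n_k M_k`. -/
def digit (n k : ℕ) : ℕ := (n / Mprod m k) % m k

/-- `⟨n⟩`, the smallest index of a nonzero digit. -/
def lowIdx (n : ℕ) : ℕ := sInf {j | digit m n j ≠ 0}

/-- `|n|`, the largest index of a nonzero digit. -/
def highIdx (n : ℕ) : ℕ := sSup {j | digit m n j ≠ 0}

/-- Generalized Rademacher functions `r_k(x) = exp(2πi x_k / m_k)`. -/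
def rad (k : ℕ) (x : G m) : ℂ :=
  Complex.exp (2 * Real.pi * Complex.I * ((x k).val : ℂ) / (m k : ℂ))

/-- The Vilenkin system `ψ_n = ∏_k r_k^{n_k}`. -/
def psi (n : ℕ) (x : G m) : ℂ :=
  ∏ k ∈ Finset.range (n + 1), rad m k x ^ digit m n k

/-- Dirichlet kernels `D_n = Σ_{k<n} ψ_k`. -/
def Dker (n : ℕ) (x : G m) : ℂ := ∑ k ∈ Finset.range n, psi m k x

/-- Fejér kernels `K_n = (1/n) Σ_{k<n} D_k`. -/
def Kker (n : ℕ) (x : G m) : ℂ := (n : ℂ)⁻¹ * ∑ k ∈ Finset.range n, Dker m k x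

/-- The cylinder `I_n(x)`. -/
def cylinder (n : ℕ) (x : G m) : Set (G m) := {y | ∀ j, j < n → y j = x j}

/-- `e_t`: the element with `t`-th coordinate `1` and all others `0`. -/
def eVec (t : ℕ) : G m := fun j => if j = t then 1 else 0

/-- The filtration `F_n` generated by the cylinders of level `n`. -/
def filtr (n : ℕ) : MeasurableSpace (G m) :=
  MeasurableSpace.comap (fun x (j : Fin n) => x j.val) inferInstance

/-- The normalized Haar measure on `G_m`: the probability measure giving each cylinder
`I_n(x)` measure `1/M_n`. -/
def IsVilenkinMeasure (μ : Measure (G m)) : Prop :=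
  IsProbabilityMeasure μ ∧ ∀ n x, μ (cylinder m n x) = (Mprod m n : ℝ≥0∞)⁻¹

/-- Martingales with respect to the filtration `(F_n)`. -/
def IsMartingale (μ : Measure (G m)) (f : ℕ → G m → ℂ) : Prop :=
  (∀ n, Integrable (f n) μ) ∧
  (∀ n, Measurable[filtr m n] (f n)) ∧
  (∀ n, ∀ s : Set (G m), MeasurableSet[filtr m n] s →
    ∫ x in s, f (n + 1) x ∂μ = ∫ x in s, f n x ∂μ)

/-- The maximal function `f* = sup_n |f^{(n)}|` (with values in `ℝ≥0∞`). -/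
def maximalFn (f : ℕ → G m → ℂ) (x : G m) : ℝ≥0∞ := ⨆ n, (‖f n x‖₊ : ℝ≥0∞)

/-- The martingale Hardy space quasi-norm `‖f‖_{H_p} = ‖f*‖_{L_p}`. -/
def hardyNorm (p : ℝ) (μ : Measure (G m)) (f : ℕ → G m → ℂ) : ℝ≥0∞ :=
  (∫⁻ x, maximalFn m f x ^ p ∂μ) ^ (1 / p)

/-- Vilenkin-Fourier coefficients of an integrable function. -/
def fourierCoeff (μ : Measure (G m)) (g : G m → ℂ) (k : ℕ) : ℂ :=
  ∫ x, g x * (starRingEnd ℂ) (psi m k x) ∂μ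

/-- Partial sums `S_n g` of the Vilenkin-Fourier series of a function. -/
def SFun (μ : Measure (G m)) (g : G m → ℂ) (n : ℕ) (x : G m) : ℂ :=
  ∑ k ∈ Finset.range n, fourierCoeff m μ g k * psi m k x

/-- Fejér means `σ_n g` of a function. -/
def sigmaFun (μ : Measure (G m)) (g : G m → ℂ) (n : ℕ) (x : G m) : ℂ :=
  (n : ℂ)⁻¹ * ∑ k ∈ Finset.range n, SFun m μ g k x

/-- Vilenkin-Fourier coefficients of a martingale:
`f̂(i) = lim_k ∫ f^{(k)} ψ̄_i dμ`. -/
def martCoeff (μ : Measure (G m)) (f : ℕ → G m → ℂ) (i : ℕ) : ℂ :=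
  limUnder atTop fun k => ∫ x, f k x * (starRingEnd ℂ) (psi m i x) ∂μ

/-- Partial sums `S_n f` of the Vilenkin-Fourier series of a martingale. -/
def SMart (μ : Measure (G m)) (f : ℕ → G m → ℂ) (n : ℕ) (x : G m) : ℂ :=
  ∑ k ∈ Finset.range n, martCoeff m μ f k * psi m k x

/-- Fejér means `σ_n f` of a martingale. -/
def sigmaMart (μ : Measure (G m)) (f : ℕ → G m → ℂ) (n : ℕ) (x : G m) : ℂ :=
  (n : ℂ)⁻¹ * ∑ k ∈ Finset.range n, SMart m μ f k x

/-- The weak `L_p` quasi-norm `‖g‖_{L_{p,∞}} = (sup_λ λ^p μ(|g|>λ))^{1/p}`. -/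
def weakNorm (p : ℝ) (μ : Measure (G m)) (g : G m → ℂ) : ℝ≥0∞ :=
  (⨆ lam : ℝ≥0, (lam : ℝ≥0∞) ^ p * μ {x | (lam : ℝ) < ‖g x‖}) ^ (1 / p)

/-- A `p`-atom with prescribed support interval `I_N(x₀)`. -/
def IsPAtomAt (p : ℝ) (μ : Measure (G m)) (N : ℕ) (x₀ : G m) (a : G m → ℂ) : Prop :=
  Measurable a ∧ Function.support a ⊆ cylinder m N x₀ ∧
    (∫ x in cylinder m N x₀, a x ∂μ) = 0 ∧
    eLpNorm a ⊤ μ ≤ μ (cylinder m N x₀) ^ (-(1 / p))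

/-- A `p`-atom. -/
def IsPAtom (p : ℝ) (μ : Measure (G m)) (a : G m → ℂ) : Prop :=
  ∃ N x₀, IsPAtomAt m p μ N x₀ a

/-- The sets `I_N^{i,j}` for `i < j ≤ N`. -/
def IsetIJ (N i j : ℕ) : Set (G m) :=
  if j < N then
    {x | (∀ l, l < i → x l = 0) ∧ x i ≠ 0 ∧ (∀ l, i < l → l < j → x l = 0) ∧ x j ≠ 0}
  else
    {x | (∀ l, l < i → x l = 0) ∧ x i ≠ 0 ∧ (∀ l, i < l → l < N → x l = 0)}

section Kernels

variable {m}

lemma Mprod_pos (hm : ∀ n, 2 ≤ m n) (n : ℕ) : 0 < Mprod m n := by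
  induction n with
  | zero => simp [Mprod]
  | succ n ih => exact Nat.mul_pos (by have := hm n; omega) ih

lemma two_mul_Mprod_le (hm : ∀ n, 2 ≤ m n) (n : ℕ) : 2 * Mprod m n ≤ Mprod m (n + 1) :=
  Nat.mul_le_mul_right _ (hm n)

lemma Mprod_mono (hm : ∀ n, 2 ≤ m n) : Monotone (Mprod m) :=
  monotone_nat_of_le_succ fun n => by have := two_mul_Mprod_le hm n; omega

lemma lt_Mprod (hm : ∀ n, 2 ≤ m n) (n : ℕ) : n < Mprod m n := by
  induction n with
  | zero => simp [Mprod]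
  | succ n ih => have := two_mul_Mprod_le hm n; omega

lemma mul_Mprod_le_Mprod_add (hm : ∀ n, 2 ≤ m n) (n d : ℕ) :
    (d + 1) * Mprod m n ≤ Mprod m (n + d) := by
  induction d with
  | zero => simp
  | succ d ih =>
    have h := two_mul_Mprod_le hm (n + d)
    rw [← add_assoc]
    nlinarith [Nat.zero_le (d * Mprod m n)]

lemma sum_Mprod_le (hm : ∀ n, 2 ≤ m n) (n : ℕ) :
    ∑ a ∈ Finset.range (n + 1), Mprod m a ≤ 2 * Mprod m n := by
  induction n with
  | zero => simp [Mprod]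
  | succ n ih =>
    rw [Finset.sum_range_succ]
    have := two_mul_Mprod_le hm n
    omega

lemma Mprod_dvd_Mprod {a b : ℕ} (h : a ≤ b) : Mprod m a ∣ Mprod m b := by
  induction b, h using Nat.le_induction with
  | base => exact dvd_rfl
  | succ b _ ih => exact ih.trans (Dvd.intro_left _ rfl)

lemma digit_eq_zero (hm : ∀ n, 2 ≤ m n) {n A l : ℕ} (hn : n < Mprod m A) (hl : A ≤ l) :
    digit m n l = 0 := by
  rw [digit, Nat.div_eq_of_lt (hn.trans_le (Mprod_mono hm hl)), Nat.zero_mod]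

lemma digit_mul_add_of_lt (hm : ∀ n, 2 ≤ m n) (s k : ℕ) {A l : ℕ} (hl : l < A) :
    digit m (s * Mprod m A + k) l = digit m k l := by
  obtain ⟨q, hq⟩ := Mprod_dvd_Mprod (m := m) (Nat.succ_le_of_lt hl)
  have h : s * Mprod m A + k = k + Mprod m l * (m l * (s * q)) := by
    rw [hq, Mprod]; ring
  rw [digit, digit, h, Nat.add_mul_div_left _ _ (Mprod_pos hm l), Nat.add_mul_mod_self_left]

lemma digit_mul_add_self (hm : ∀ n, 2 ≤ m n) {s k A : ℕ} (hs : s < m A) (hk : k < Mprod m A) :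
    digit m (s * Mprod m A + k) A = s := by
  rw [digit, add_comm, Nat.add_mul_div_right _ _ (Mprod_pos hm A), Nat.div_eq_of_lt hk, zero_add,
    Nat.mod_eq_of_lt hs]

lemma psi_eq_prod_range (hm : ∀ n, 2 ≤ m n) {n A : ℕ} (hn : n < Mprod m A) (y : G m) :
    psi m n y = ∏ k ∈ Finset.range A, rad m k y ^ digit m n k := by
  have hn' : n < Mprod m (n + 1) := (lt_Mprod hm n).trans_le (Mprod_mono hm n.le_succ)
  rcases le_total A (n + 1) with h | h
  · refine (Finset.prod_subset (Finset.range_mono h) fun k _ hk => ?_).symm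
    rw [digit_eq_zero hm hn (by simpa using hk), pow_zero]
  · refine Finset.prod_subset (Finset.range_mono h) fun k _ hk => ?_
    rw [digit_eq_zero hm hn' (by simpa using hk), pow_zero]

lemma psi_mul_add (hm : ∀ n, 2 ≤ m n) {s k A : ℕ} (hs : s < m A) (hk : k < Mprod m A) (y : G m) :
    psi m (s * Mprod m A + k) y = rad m A y ^ s * psi m k y := by
  have hlt : s * Mprod m A + k < Mprod m (A + 1) := by
    have : (s + 1) * Mprod m A ≤ m A * Mprod m A := Nat.mul_le_mul_right _ hs
    rw [Mprod]; linarith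
  rw [psi_eq_prod_range hm hlt, Finset.prod_range_succ, digit_mul_add_self hm hs hk,
    psi_eq_prod_range hm hk, mul_comm]
  congr 1
  refine Finset.prod_congr rfl fun l hl => ?_
  rw [digit_mul_add_of_lt hm s k (Finset.mem_range.1 hl)]

lemma rad_eq_pow (k : ℕ) (y : G m) :
    rad m k y = Complex.exp (2 * Real.pi * Complex.I / (m k : ℂ)) ^ (y k).val := by
  rw [rad, ← Complex.exp_nat_mul]
  congr 1
  ring

lemma norm_rad (k : ℕ) (y : G m) : ‖rad m k y‖ = 1 := by
  have h : (2 * Real.pi * Complex.I * ((y k).val : ℂ) / (m k : ℂ)) =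
      ((2 * Real.pi * (y k).val / m k : ℝ) : ℂ) * Complex.I := by push_cast; ring
  rw [rad, h, Complex.norm_exp_ofReal_mul_I]

lemma geom_sum_rad_eq_zero (hm : ∀ n, 2 ≤ m n) {k : ℕ} {y : G m} (hy : y k ≠ 0) :
    ∑ q ∈ Finset.range (m k), rad m k y ^ q = 0 := by
  have hk : m k ≠ 0 := by have := hm k; omega
  have : NeZero (m k) := ⟨hk⟩
  have hζ := Complex.isPrimitiveRoot_exp (m k) hk
  have hone : rad m k y ≠ 1 := by
    rw [rad_eq_pow, Ne, hζ.pow_eq_one_iff_dvd]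
    intro hdvd
    exact hy ((ZMod.val_eq_zero _).1 (Nat.eq_zero_of_dvd_of_lt hdvd (ZMod.val_lt _)))
  have hpow : rad m k y ^ m k = 1 := by
    rw [rad_eq_pow, pow_right_comm, hζ.pow_eq_one, one_pow]
  rw [geom_sum_eq hone, hpow, sub_self, zero_div]

lemma norm_geom_sum_rad_le (k s : ℕ) (y : G m) :
    ‖∑ q ∈ Finset.range s, rad m k y ^ q‖ ≤ s :=
  (norm_sum_le _ _).trans (by simp [norm_rad])

lemma norm_psi (n : ℕ) (y : G m) : ‖psi m n y‖ = 1 := by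
  simp [psi, norm_rad]

lemma norm_Dker_le (n : ℕ) (y : G m) : ‖Dker m n y‖ ≤ n :=
  (norm_sum_le _ _).trans (by simp [norm_psi])

variable (m) in
/-- The unnormalized Fejér kernel `n K_n = Σ_{k<n} D_k`. -/
def Fsum (n : ℕ) (y : G m) : ℂ := ∑ k ∈ Finset.range n, Dker m k y

lemma norm_Fsum_le (n : ℕ) (y : G m) : ‖Fsum m n y‖ ≤ (n : ℝ) * n := by
  refine (norm_sum_le_of_le (f := fun k => Dker m k y) (n := fun _ => (n : ℝ)) _
    fun k hk => (norm_Dker_le k y).trans ?_).trans (by simp)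
  exact_mod_cast (Finset.mem_range.1 hk).le

lemma Dker_mul_add (hm : ∀ n, 2 ≤ m n) {s k A : ℕ} (hs : s < m A) (hk : k ≤ Mprod m A)
    (y : G m) :
    Dker m (s * Mprod m A + k) y = Dker m (s * Mprod m A) y + rad m A y ^ s * Dker m k y := by
  rw [Dker, Finset.sum_range_add, Dker, Dker, Finset.mul_sum]
  congr 1
  refine Finset.sum_congr rfl fun l hl => ?_
  exact psi_mul_add hm hs ((Finset.mem_range.1 hl).trans_le hk) y

lemma Dker_mul (hm : ∀ n, 2 ≤ m n) {s A : ℕ} (hs : s ≤ m A) (y : G m) :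
    Dker m (s * Mprod m A) y =
      (∑ q ∈ Finset.range s, rad m A y ^ q) * Dker m (Mprod m A) y := by
  induction s with
  | zero => simp [Dker]
  | succ s ih =>
    rw [add_one_mul, Dker_mul_add hm hs le_rfl, ih (by omega), Finset.sum_range_succ, add_mul]

lemma norm_Dker_mul_le (hm : ∀ n, 2 ≤ m n) {s A : ℕ} (hs : s ≤ m A) (y : G m) :
    ‖Dker m (s * Mprod m A) y‖ ≤ s * ‖Dker m (Mprod m A) y‖ := by
  rw [Dker_mul hm hs, norm_mul]
  gcongr
  exact norm_geom_sum_rad_le A s y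

lemma Fsum_mul_add (hm : ∀ n, 2 ≤ m n) {s k A : ℕ} (hs : s < m A) (hk : k ≤ Mprod m A)
    (y : G m) :
    Fsum m (s * Mprod m A + k) y =
      Fsum m (s * Mprod m A) y + k * Dker m (s * Mprod m A) y + rad m A y ^ s * Fsum m k y := by
  have h : ∀ l ∈ Finset.range k, Dker m (s * Mprod m A + l) y =
      Dker m (s * Mprod m A) y + rad m A y ^ s * Dker m l y := fun l hl =>
    Dker_mul_add hm hs ((Finset.mem_range.1 hl).le.trans hk) y
  rw [Fsum, Finset.sum_range_add, Finset.sum_congr rfl h, Finset.sum_add_distrib, Fsum, Fsum,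
    ← Finset.mul_sum]
  simp [add_assoc]

lemma norm_Fsum_mul_le (hm : ∀ n, 2 ≤ m n) {s A : ℕ} (hs : s ≤ m A) (y : G m) :
    ‖Fsum m (s * Mprod m A) y‖ ≤
      s * (s * (Mprod m A * ‖Dker m (Mprod m A) y‖) + ‖Fsum m (Mprod m A) y‖) := by
  induction s with
  | zero => simp [Fsum]
  | succ s ih =>
    rw [add_one_mul, Fsum_mul_add hm hs le_rfl]
    refine (norm_add₃_le).trans ?_
    have h₁ := ih (by omega)
    have h₂ := mul_le_mul_of_nonneg_left (norm_Dker_mul_le hm (by omega : s ≤ m A) y)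
      (Nat.cast_nonneg (α := ℝ) (Mprod m A))
    rw [norm_mul, norm_mul, norm_pow, norm_rad, one_pow, one_mul, Complex.norm_natCast]
    have h₃ : (0 : ℝ) ≤ Mprod m A * ‖Dker m (Mprod m A) y‖ := by positivity
    have h₄ : (0 : ℝ) ≤ s * (Mprod m A * ‖Dker m (Mprod m A) y‖) := by positivity
    push_cast
    nlinarith

lemma Fsum_mul_of_Dker_eq_zero (hm : ∀ n, 2 ≤ m n) {s A : ℕ} (hs : s ≤ m A) {y : G m}
    (hD : Dker m (Mprod m A) y = 0) :
    Fsum m (s * Mprod m A) y =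
      (∑ q ∈ Finset.range s, rad m A y ^ q) * Fsum m (Mprod m A) y := by
  induction s with
  | zero => simp [Fsum]
  | succ s ih =>
    rw [add_one_mul, Fsum_mul_add hm hs le_rfl, ih (by omega), Dker_mul hm (by omega), hD,
      Finset.sum_range_succ]
    ring

variable (m) in
/-- The contribution of level `A` to the bound for the unnormalized Fejér kernels. -/
def levelBound (B : ℝ) (A : ℕ) (y : G m) : ℝ :=
  B * ‖Fsum m (Mprod m A) y‖ + (B * B + B) * (Mprod m A * ‖Dker m (Mprod m A) y‖)

lemma norm_Fsum_le_sum_levelBound (hm : ∀ n, 2 ≤ m n) {B : ℕ} (hB : ∀ n, m n ≤ B) (y : G m)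
    {A n : ℕ} (hn : n < Mprod m A) :
    ‖Fsum m n y‖ ≤ ∑ a ∈ Finset.range A, levelBound m B a y := by
  induction A generalizing n with
  | zero =>
    have : n = 0 := by simpa [Mprod] using hn
    simp [this, Fsum]
  | succ A ih =>
    have hpos := Mprod_pos hm A
    have hs : n / Mprod m A < m A := Nat.div_lt_of_lt_mul (by rwa [mul_comm])
    have hk := Nat.mod_lt n hpos
    rw [← Nat.div_add_mod' n (Mprod m A)]
    set s := n / Mprod m A
    set k := n % Mprod m A
    rw [Fsum_mul_add hm hs hk.le, Finset.sum_range_succ]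
    refine (norm_add₃_le).trans ?_
    rw [norm_mul, norm_mul, norm_pow, norm_rad, one_pow, one_mul, Complex.norm_natCast]
    have h₁ := norm_Fsum_mul_le hm hs.le y
    have h₂ := norm_Dker_mul_le hm hs.le y
    have h₃ := ih hk
    have hsB : (s : ℝ) ≤ B := by exact_mod_cast hs.le.trans (hB A)
    have hkM : (k : ℝ) ≤ Mprod m A := by exact_mod_cast hk.le
    have h₄ : (k : ℝ) * ‖Dker m (s * Mprod m A) y‖ ≤
        B * (Mprod m A * ‖Dker m (Mprod m A) y‖) := by
      calc _ ≤ (Mprod m A : ℝ) * (B * ‖Dker m (Mprod m A) y‖) := by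
            gcongr; exact h₂.trans (by gcongr)
        _ = _ := by ring
    have h₅ : s * (s * (Mprod m A * ‖Dker m (Mprod m A) y‖) + ‖Fsum m (Mprod m A) y‖) ≤
        (B : ℝ) * (B * (Mprod m A * ‖Dker m (Mprod m A) y‖) + ‖Fsum m (Mprod m A) y‖) := by
      gcongr
    rw [levelBound]
    linarith

lemma Dker_Mprod_eq_zero (hm : ∀ n, 2 ≤ m n) {i : ℕ} {y : G m} (hy : y i ≠ 0) {a : ℕ}
    (ha : i < a) : Dker m (Mprod m a) y = 0 := by
  induction a, ha using Nat.le_induction with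
  | base => rw [Mprod, Dker_mul hm le_rfl, geom_sum_rad_eq_zero hm hy, zero_mul]
  | succ a _ ih => rw [Mprod, Dker_mul hm le_rfl, ih, mul_zero]

lemma Fsum_Mprod_eq_zero (hm : ∀ n, 2 ≤ m n) {i j : ℕ} {y : G m} (hi : y i ≠ 0) (hij : i < j)
    (hj : y j ≠ 0) {a : ℕ} (ha : j < a) : Fsum m (Mprod m a) y = 0 := by
  induction a, ha using Nat.le_induction with
  | base =>
    rw [Mprod, Fsum_mul_of_Dker_eq_zero hm le_rfl (Dker_Mprod_eq_zero hm hi hij),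
      geom_sum_rad_eq_zero hm hj, zero_mul]
  | succ a ha ih =>
    rw [Mprod, Fsum_mul_of_Dker_eq_zero hm le_rfl (Dker_Mprod_eq_zero hm hi (by omega)), ih,
      mul_zero]

lemma norm_Fsum_Mprod_le (hm : ∀ n, 2 ≤ m n) {B : ℕ} (hB : ∀ n, m n ≤ B) {i : ℕ} {y : G m}
    (hi : y i ≠ 0) (a : ℕ) :
    ‖Fsum m (Mprod m a) y‖ ≤ B * (Mprod m i * Mprod m a) := by
  rcases le_or_gt a i with ha | ha
  · refine (norm_Fsum_le _ y).trans ?_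
    have h₁ : Mprod m a ≤ Mprod m i := Mprod_mono hm ha
    have h₂ : 1 ≤ B := by have := hm 0; have := hB 0; omega
    have h₃ : Mprod m a ≤ B * Mprod m i := h₁.trans (Nat.le_mul_of_pos_left _ h₂)
    calc (Mprod m a : ℝ) * Mprod m a ≤ (B * Mprod m i) * Mprod m a := by
          gcongr; exact_mod_cast h₃
      _ = _ := by ring
  · induction a, ha using Nat.le_induction with
    | base =>
      refine (norm_Fsum_le _ y).trans ?_
      have h : Mprod m (i + 1) ≤ B * Mprod m i := Nat.mul_le_mul_right _ (hB i)
      calc (Mprod m (i + 1) : ℝ) * Mprod m (i + 1) ≤ (B * Mprod m i) * Mprod m (i + 1) := by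
            gcongr; exact_mod_cast h
        _ = _ := by ring
    | succ a ha ih =>
      rw [Mprod, Fsum_mul_of_Dker_eq_zero hm le_rfl (Dker_Mprod_eq_zero hm hi ha), norm_mul]
      calc _ ≤ (m a : ℝ) * (B * (Mprod m i * Mprod m a)) := by
            gcongr; exact norm_geom_sum_rad_le _ _ _
        _ = _ := by push_cast; ring

lemma levelBound_le (hm : ∀ n, 2 ≤ m n) {B : ℕ} (hB : ∀ n, m n ≤ B) {i : ℕ} {y : G m}
    (hi : y i ≠ 0) (a : ℕ) :
    levelBound m B a y ≤ (2 * B * B + B) * Mprod m i * Mprod m a := by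
  have h₁ := mul_le_mul_of_nonneg_left (norm_Fsum_Mprod_le hm hB hi a) (Nat.cast_nonneg (α := ℝ) B)
  have h₂ : (Mprod m a : ℝ) * ‖Dker m (Mprod m a) y‖ ≤ Mprod m i * Mprod m a := by
    rcases le_or_gt a i with ha | ha
    · rw [mul_comm]
      gcongr
      refine (norm_Dker_le _ y).trans ?_
      exact_mod_cast Mprod_mono hm ha
    · rw [Dker_Mprod_eq_zero hm hi ha, norm_zero, mul_zero]
      positivity
  have h₃ := mul_le_mul_of_nonneg_left h₂ (by positivity : (0 : ℝ) ≤ B * B + B)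
  rw [levelBound]
  linarith

lemma levelBound_eq_zero (hm : ∀ n, 2 ≤ m n) (B : ℝ) {i j : ℕ} {y : G m} (hi : y i ≠ 0)
    (hij : i < j) (hj : y j ≠ 0) {a : ℕ} (ha : j < a) : levelBound m B a y = 0 := by
  rw [levelBound, Fsum_Mprod_eq_zero hm hi hij hj ha, Dker_Mprod_eq_zero hm hi (hij.trans ha)]
  simp

lemma sum_levelBound_le (hm : ∀ n, 2 ≤ m n) {B : ℕ} (hB : ∀ n, m n ≤ B) {i : ℕ} {y : G m}
    (hi : y i ≠ 0) (j : ℕ) :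
    ∑ a ∈ Finset.range (j + 1), levelBound m B a y ≤
      2 * ((2 * B * B + B) * Mprod m i * Mprod m j) := by
  have h : (∑ a ∈ Finset.range (j + 1), (Mprod m a : ℝ)) ≤ 2 * Mprod m j := by
    exact_mod_cast sum_Mprod_le hm j
  calc _ ≤ ∑ a ∈ Finset.range (j + 1), (2 * B * B + B : ℝ) * Mprod m i * Mprod m a :=
        Finset.sum_le_sum fun a _ => levelBound_le hm hB hi a
    _ = (2 * B * B + B : ℝ) * Mprod m i * ∑ a ∈ Finset.range (j + 1), (Mprod m a : ℝ) := by
        rw [Finset.mul_sum]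
    _ ≤ (2 * B * B + B : ℝ) * Mprod m i * (2 * Mprod m j) := by gcongr
    _ = _ := by ring

lemma norm_Fsum_le_of_ne_zero (hm : ∀ n, 2 ≤ m n) {B : ℕ} (hB : ∀ n, m n ≤ B) {i j : ℕ} {y : G m}
    (hi : y i ≠ 0) (hij : i < j) (hj : y j ≠ 0) (n : ℕ) :
    ‖Fsum m n y‖ ≤ 2 * ((2 * B * B + B) * Mprod m i * Mprod m j) := by
  have hn : n < Mprod m (n + j + 1) := (lt_Mprod hm n).trans_le (Mprod_mono hm (by omega))
  refine (norm_Fsum_le_sum_levelBound hm hB y hn).trans (le_trans (le_of_eq ?_)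
    (sum_levelBound_le hm hB hi j))
  refine (Finset.sum_subset (Finset.range_mono (by omega)) fun a _ ha => ?_).symm
  exact levelBound_eq_zero hm B hi hij hj (by simpa using ha)

open Classical in
lemma norm_Fsum_le_add_sum (hm : ∀ n, 2 ≤ m n) {B : ℕ} (hB : ∀ n, m n ≤ B) {i N L : ℕ} {y : G m}
    (hi : y i ≠ 0) (hiN : i < N) (hNL : N ≤ L) {n : ℕ} (hn : n < Mprod m (L + 1)) :
    ‖Fsum m n y‖ ≤ 2 * ((2 * B * B + B) * Mprod m i * Mprod m N) +
      ∑ a ∈ Finset.Ico (N + 1) (L + 1),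
        if ∀ l, N ≤ l → l < a → y l = 0 then (2 * B * B + B : ℝ) * Mprod m i * Mprod m a
        else 0 := by
  refine (norm_Fsum_le_sum_levelBound hm hB y hn).trans ?_
  rw [← Finset.sum_range_add_sum_Ico _ (by omega : N + 1 ≤ L + 1)]
  refine add_le_add (sum_levelBound_le hm hB hi N) (Finset.sum_le_sum fun a _ => ?_)
  split_ifs with h
  · exact levelBound_le hm hB hi a
  · push Not at h
    obtain ⟨l, hNl, hla, hl⟩ := h
    exact (levelBound_eq_zero hm B hi (hiN.trans_le hNl) hl hla).le

lemma measurableSet_cylinder (n : ℕ) (x : G m) : MeasurableSet (cylinder m n x) := by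
  have h : cylinder m n x = ⋂ j, ⋂ _ : j < n, (fun y : G m => y j) ⁻¹' {x j} := by
    ext y; simp [cylinder]
  rw [h]
  exact MeasurableSet.iInter fun j => MeasurableSet.iInter fun _ =>
    measurable_pi_apply j (by trivial)

lemma enorm_Kker_le {n : ℕ} {y : G m} {b : ℝ} (h : ‖Fsum m n y‖ ≤ b) :
    (‖Kker m n y‖₊ : ℝ≥0∞) ≤ ENNReal.ofReal (b / n) := by
  rw [← enorm_eq_nnnorm, ← ofReal_norm]
  refine ENNReal.ofReal_le_ofReal ?_
  rw [Kker, norm_mul, norm_inv, Complex.norm_natCast, div_eq_inv_mul]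
  gcongr
  exact h

lemma inv_natCast_eq_ofReal {k : ℕ} (hk : 0 < k) :
    (k : ℝ≥0∞)⁻¹ = ENNReal.ofReal ((k : ℝ)⁻¹) := by
  rw [ENNReal.ofReal_inv_of_pos (by exact_mod_cast hk), ENNReal.ofReal_natCast]

end Kernels

/-- Lemma 4: for `x ∈ I_N^{i,j}` and `n ≥ M_N`,
`∫_{I_N} |K_n(x-t)| dμ(t) ≤ c M_i M_j / M_N²`. -/
theorem fejer_kernel_integral_bound
    (m : ℕ → ℕ) (hm : ∀ n, 2 ≤ m n) (hbdd : ∃ B, ∀ n, m n ≤ B)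
    (μ : Measure (G m)) (hμ : IsVilenkinMeasure m μ) :
    ∃ c : ℝ≥0, 0 < c ∧
      ∀ N i j : ℕ, i < j → j ≤ N → ∀ x ∈ IsetIJ m N i j, ∀ n : ℕ, Mprod m N ≤ n →
        (∫⁻ t in cylinder m N 0, (‖Kker m n (x - t)‖₊ : ℝ≥0∞) ∂μ) ≤
          (c : ℝ≥0∞) * (Mprod m i : ℝ≥0∞) * (Mprod m j : ℝ≥0∞) /
            (Mprod m N : ℝ≥0∞) ^ 2 := by
  obtain ⟨B, hB⟩ := hbdd
  have hBpos : 0 < B := by have := hm 0; have := hB 0; omega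
  have hC : (0 : ℝ) < 2 * B * B + B := by positivity
  set C : ℝ := 2 * B * B + B with hCdef
  refine ⟨(3 * C).toNNReal, by simpa using hC, ?_⟩
  intro N i j hij hjN x hx n hn
  have hMpos : ∀ k, (0 : ℝ) < Mprod m k := fun k => by exact_mod_cast Mprod_pos hm k
  have hMn : (Mprod m N : ℝ) ≤ n := by exact_mod_cast hn
  have hn0 : (0 : ℝ) < n := (hMpos N).trans_le hMn
  have hrhs : ((3 * C).toNNReal : ℝ≥0∞) * (Mprod m i : ℝ≥0∞) * (Mprod m j : ℝ≥0∞) /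
      (Mprod m N : ℝ≥0∞) ^ 2 = ENNReal.ofReal (3 * C * Mprod m i * Mprod m j / Mprod m N ^ 2) := by
    rw [ENNReal.ofReal_div_of_pos (by have := hMpos N; positivity),
      ENNReal.ofReal_mul (by positivity), ENNReal.ofReal_mul (by positivity),
      ENNReal.ofReal_pow (by positivity)]
    simp only [ENNReal.ofReal_natCast]
    rfl
  rw [hrhs]
  have hcoord : ∀ t ∈ cylinder m N 0, ∀ l < N, (x - t) l = x l := by
    intro t ht l hl
    simp [ht l hl]
  have hxi : x i ≠ 0 := by
    unfold IsetIJ at hx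
    split_ifs at hx
    · exact hx.2.1
    · exact hx.2.1
  have hiN : i < N := hij.trans_le hjN
  by_cases hj : j < N
  · have hxj : x j ≠ 0 := by
      rw [IsetIJ, if_pos hj] at hx
      exact hx.2.2.2
    have hpt : ∀ t ∈ cylinder m N 0, (‖Kker m n (x - t)‖₊ : ℝ≥0∞) ≤
        ENNReal.ofReal (2 * (C * Mprod m i * Mprod m j) / n) := fun t ht =>
      enorm_Kker_le (norm_Fsum_le_of_ne_zero hm hB (by rwa [hcoord t ht i hiN]) hij
        (by rwa [hcoord t ht j hj]) n)
    refine (setLIntegral_mono' (measurableSet_cylinder N 0) hpt).trans ?_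
    rw [setLIntegral_const, hμ.2, inv_natCast_eq_ofReal (Mprod_pos hm N),
      ← ENNReal.ofReal_mul (by positivity)]
    refine ENNReal.ofReal_le_ofReal ?_
    have hi0 := hMpos i
    have hj0 := hMpos j
    have hN0 := hMpos N
    calc 2 * (C * Mprod m i * Mprod m j) / n * (Mprod m N : ℝ)⁻¹
        ≤ 3 * (C * Mprod m i * Mprod m j) / Mprod m N * (Mprod m N : ℝ)⁻¹ := by
          gcongr; norm_num
      _ = _ := by field_simp
  · obtain rfl : j = N := by omega
    classical
    have hex : ∃ L, n < Mprod m (L + 1) :=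
      ⟨n, (lt_Mprod hm n).trans_le (Mprod_mono hm n.le_succ)⟩
    obtain ⟨L, hL, hLmin⟩ : ∃ L, n < Mprod m (L + 1) ∧ ∀ k < L, ¬ n < Mprod m (k + 1) :=
      ⟨Nat.find hex, Nat.find_spec hex, fun k hk => Nat.find_min hex hk⟩
    have hjL : j ≤ L := by
      by_contra! h
      exact absurd (hL.trans_le ((Mprod_mono hm h).trans hn)) (lt_irrefl _)
    have hLn : Mprod m L ≤ n := by
      rcases Nat.eq_or_lt_of_le hjL with h | h
      · rwa [← h]
      · obtain ⟨k, rfl⟩ : ∃ k, L = k + 1 := ⟨L - 1, by omega⟩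
        exact not_lt.1 (hLmin k (by omega))
    set z : G m := fun l => if l < j then 0 else x l with hz
    have hpt : ∀ t ∈ cylinder m j 0, (‖Kker m n (x - t)‖₊ : ℝ≥0∞) ≤
        ENNReal.ofReal (2 * (C * Mprod m i * Mprod m j) / n) +
          ∑ a ∈ Finset.Ico (j + 1) (L + 1), (cylinder m a z).indicator
            (fun _ => ENNReal.ofReal (C * Mprod m i * Mprod m a / n)) t := by
      intro t ht
      refine (enorm_Kker_le (norm_Fsum_le_add_sum hm hB (by rwa [hcoord t ht i hiN]) hiN hjL
        hL)).trans ?_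
      rw [add_div, Finset.sum_div]
      refine ENNReal.ofReal_add_le.trans (add_le_add le_rfl ?_)
      rw [ENNReal.ofReal_sum_of_nonneg fun a _ => by split_ifs <;> positivity]
      refine Finset.sum_le_sum fun a _ => ?_
      split_ifs with h
      · have hmem : t ∈ cylinder m a z := by
          intro l hl
          by_cases hlj : l < j
          · simpa [hz, hlj] using ht l hlj
          · have := sub_eq_zero.1 (h l (by omega) hl)
            simp [hz, hlj, this]
        rw [Set.indicator_of_mem hmem]
      · simp
    refine (setLIntegral_mono' (measurableSet_cylinder j 0) hpt).trans ?_
    rw [lintegral_add_left measurable_const, setLIntegral_const, hμ.2,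
      inv_natCast_eq_ofReal (Mprod_pos hm j), ← ENNReal.ofReal_mul (by positivity),
      lintegral_finsetSum _ fun a _ => measurable_const.indicator (measurableSet_cylinder a z)]
    have hterm : ∀ a ∈ Finset.Ico (j + 1) (L + 1),
        ∫⁻ t in cylinder m j 0, (cylinder m a z).indicator
          (fun _ => ENNReal.ofReal (C * Mprod m i * Mprod m a / n)) t ∂μ ≤
        ENNReal.ofReal (C * Mprod m i / n) := by
      intro a _
      refine (setLIntegral_le_lintegral _ _).trans ?_
      rw [lintegral_indicator_const (measurableSet_cylinder a z), hμ.2,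
        inv_natCast_eq_ofReal (Mprod_pos hm a), ← ENNReal.ofReal_mul (by positivity)]
      refine ENNReal.ofReal_le_ofReal (le_of_eq ?_)
      have := hMpos a
      field_simp
    refine (add_le_add le_rfl (Finset.sum_le_sum hterm)).trans ?_
    rw [← ENNReal.ofReal_sum_of_nonneg fun a _ => by positivity,
      ← ENNReal.ofReal_add (by positivity) (Finset.sum_nonneg fun a _ => by positivity)]
    refine ENNReal.ofReal_le_ofReal ?_
    rw [Finset.sum_const, Nat.card_Ico, nsmul_eq_mul]
    have hcount : ((L + 1 - (j + 1) : ℕ) : ℝ) * Mprod m j ≤ n := by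
      have h := mul_Mprod_le_Mprod_add hm j (L - j)
      rw [Nat.add_sub_cancel' hjL] at h
      have h' : (L + 1 - (j + 1)) * Mprod m j ≤ (L - j + 1) * Mprod m j :=
        Nat.mul_le_mul_right _ (by omega)
      exact_mod_cast h'.trans (h.trans hLn)
    have hj0 := hMpos j
    have hi0 := hMpos i
    have h₁ : 2 * (C * Mprod m i * Mprod m j) / n * (Mprod m j : ℝ)⁻¹ ≤
        2 * (C * Mprod m i) / Mprod m j := by
      calc _ = 2 * (C * Mprod m i) / n := by field_simp
        _ ≤ _ := by gcongr
    have h₂ : ((L + 1 - (j + 1) : ℕ) : ℝ) * (C * Mprod m i / n) ≤ C * Mprod m i / Mprod m j := by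
      rw [← mul_div_assoc, div_le_div_iff₀ hn0 hj0]
      calc _ = C * Mprod m i * (((L + 1 - (j + 1) : ℕ) : ℝ) * Mprod m j) := by ring
        _ ≤ _ := by gcongr
    refine (add_le_add h₁ h₂).trans (le_of_eq ?_)
    field_simp
    ring

end Vilenkin
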